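/- Let p, q be nonnegative integers. There exist a constant C > 0, a real ε > 0 and a natural number N (all depending only on p and q) such that the following holds: for every n ≥ N and every strictly increasing sequence of real numbers x_1 < x_2 < … < x_n with ∑_{k=1}^n x_k = 0, ∑_{k=1}^n x_k^2 = 1 and ∑_{k=1}^n |x_k|^3 ≤ ε, and for every t ∈ ℝ, one has |t^p ∂_t^q( (1/√(2π)) e^{−t²/2} − ∑_{k=1}^n (x_k − t/n)_+^{n−2} / ∏_{j≠k}(x_k − x_j) )| ≤ C ∑_{k=1}^n |x_k|^3. -/

import Mathlib

open Real Finset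

theorem sum_pow_div_prod_sub_eq_zero {ι : Type*} [Fintype ι] [DecidableEq ι] {v : ι → ℝ}
    (hv : Function.Injective v) (c : ℝ) {m : ℕ} (hm : m + 2 ≤ Fintype.card ι) :
    ∑ k, (v k - c) ^ m / ∏ j ∈ univ.erase k, (v k - v j) = 0 := by
  have hdeg : (((Polynomial.X : Polynomial ℝ) - Polynomial.C c) ^ m).natDegree = m := by
    rw [Polynomial.natDegree_pow, Polynomial.natDegree_X_sub_C, mul_one]
  have h := Lagrange.coeff_eq_sum (s := univ) (v := v) hv.injOn
    (P := ((Polynomial.X : Polynomial ℝ) - Polynomial.C c) ^ m) (by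
      rw [Polynomial.degree_pow, Polynomial.degree_X_sub_C, nsmul_one, Finset.card_univ]
      exact_mod_cast (by omega : m < Fintype.card ι))
  rw [Polynomial.coeff_eq_zero_of_natDegree_lt (by rw [hdeg, Finset.card_univ]; omega)] at h
  simpa using h.symm

theorem pow_mul_prod_one_sub_mul_inv {ι : Type*} [Fintype ι] [DecidableEq ι] {a : ι → ℂ}
    (ha : Function.Injective a) {w : ℂ} (hw0 : w ≠ 0) (hw : ∀ k, 1 - w * a k ≠ 0) {q : ℕ}
    (hq : q + 1 ≤ Fintype.card ι) :
    w ^ q * ∏ k, (1 - w * a k)⁻¹ =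
      ∑ k, a k ^ (Fintype.card ι - 1 - q) / (∏ j ∈ univ.erase k, (a k - a j)) *
        (1 - w * a k)⁻¹ := by
  set m := Fintype.card ι - 1 - q with hm
  have hfac : ∀ k, w⁻¹ - a k = w⁻¹ * (1 - w * a k) := fun k => by field_simp
  have hne : ∀ k ∈ univ, w⁻¹ ≠ a k := fun k _ h => by
    have := hfac k
    rw [h, sub_self, eq_comm, mul_eq_zero] at this
    rcases this with h' | h'
    · exact hw0 (inv_eq_zero.mp (h.trans h'))
    · exact hw k h'
  have h1 := Lagrange.eval_interpolate_not_at_node (s := univ) (v := a) (fun k => a k ^ m) hne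
  have h2 : (Polynomial.X : Polynomial ℂ) ^ m =
      Lagrange.interpolate univ a fun k => (a k) ^ m := by
    have := Lagrange.eq_interpolate (s := univ) (v := a) (f := (Polynomial.X : Polynomial ℂ) ^ m)
      ha.injOn (by
        rw [Polynomial.degree_X_pow, Finset.card_univ]
        exact_mod_cast (by omega : m < Fintype.card ι))
    simpa using this
  rw [← h2, Lagrange.eval_nodal] at h1
  simp only [Polynomial.eval_pow, Polynomial.eval_X, hfac, Lagrange.nodalWeight,
    Finset.prod_mul_distrib, Finset.prod_const, Finset.card_univ, Finset.prod_inv_distrib,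
    mul_inv, inv_inv] at h1
  have hP : ∏ k, (1 - w * a k) ≠ 0 := Finset.prod_ne_zero_iff.mpr fun k _ => hw k
  have hcard : Fintype.card ι = m + q + 1 := by omega
  have h3 : ∑ k, (∏ j ∈ univ.erase k, (a k - a j))⁻¹ * (w * (1 - w * a k)⁻¹) * a k ^ m =
      w * ∑ k, a k ^ m / (∏ j ∈ univ.erase k, (a k - a j)) * (1 - w * a k)⁻¹ := by
    rw [Finset.mul_sum]
    exact Finset.sum_congr rfl fun k _ => by ring
  rw [h3, hcard] at h1
  rw [Finset.prod_inv_distrib]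
  have hinv : ∀ l : ℕ, w ^ l * w⁻¹ ^ l = 1 := fun l => by
    rw [← mul_pow, mul_inv_cancel₀ hw0, one_pow]
  have h4 := congrArg (fun y => w ^ (m + q) * y) h1
  have hl : w ^ (m + q) * w⁻¹ ^ m = w ^ q := by
    rw [pow_add]; linear_combination w ^ q * hinv m
  simp only [hl] at h4
  generalize ∑ k, a k ^ m / (∏ j ∈ univ.erase k, (a k - a j)) * (1 - w * a k)⁻¹ = S at h4 ⊢
  generalize ∏ k, (1 - w * a k) = P at h4 hP ⊢
  have h5 : w ^ q = P * S := by
    rw [h4, pow_succ w⁻¹]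
    linear_combination P * S * w⁻¹ * w * hinv (m + q) + P * S * mul_inv_cancel₀ hw0
  rw [h5, mul_comm P, mul_assoc, mul_inv_cancel₀ hP, mul_one]

theorem integral_mul_one_sub_mul_inv (a τ M : ℝ) (h : 0 < 1 - τ * a) :
    ∫ r in (-M)..M, (a : ℂ) * (1 - ((τ : ℂ) + Complex.I * r) * a)⁻¹ =
      ((2 * arctan (a / (1 - τ * a) * M) : ℝ) : ℂ) := by
  set c := 1 - τ * a with hc
  have hpos : ∀ r : ℝ, 0 < c ^ 2 + a ^ 2 * r ^ 2 := fun r => by positivity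
  have hre : ∀ r : ℝ, (a : ℂ) * (1 - ((τ : ℂ) + Complex.I * r) * a)⁻¹ =
      ((a * c / (c ^ 2 + a ^ 2 * r ^ 2) : ℝ) : ℂ) +
        ((a ^ 2 * r / (c ^ 2 + a ^ 2 * r ^ 2) : ℝ) : ℂ) * Complex.I := fun r => by
    have h1 : (1 - ((τ : ℂ) + Complex.I * r) * a) = (c : ℂ) - Complex.I * a * r := by
      rw [hc]; push_cast; ring
    have h2 : (c : ℂ) - Complex.I * a * r ≠ 0 := fun h0 => by
      have := congrArg Complex.re h0
      simp at this
      exact h.ne' this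
    have h3 : ((c : ℂ) ^ 2 + a ^ 2 * r ^ 2) ≠ 0 := by exact_mod_cast (hpos r).ne'
    rw [h1, ← div_eq_mul_inv, div_eq_iff h2]
    push_cast
    field_simp
    linear_combination (a : ℂ) ^ 3 * r ^ 2 * Complex.I_sq
  have hder : ∀ r : ℝ, HasDerivAt
      (fun r : ℝ => ((arctan (a / c * r) : ℝ) : ℂ) +
        ((1 / 2 * Real.log (c ^ 2 + a ^ 2 * r ^ 2) : ℝ) : ℂ) * Complex.I)
      ((a : ℂ) * (1 - ((τ : ℂ) + Complex.I * r) * a)⁻¹) r := fun r => by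
    rw [hre]
    refine (HasDerivAt.ofReal_comp ?_).add ((HasDerivAt.ofReal_comp ?_).mul_const _)
    · convert ((hasDerivAt_id' r).const_mul (a / c)).arctan using 1
      have := (hpos r).ne'
      field_simp
    · refine ((((hasDerivAt_pow 2 r).const_mul (a ^ 2)).const_add (c ^ 2)).log
        (hpos r).ne' |>.const_mul (1 / 2 : ℝ)).congr_deriv ?_
      push_cast
      ring
  rw [intervalIntegral.integral_eq_sub_of_hasDerivAt (fun r _ => hder r)]
  · simp only [mul_neg, arctan_neg, neg_sq]
    push_cast
    ring
  · refine Continuous.intervalIntegrable ?_ _ _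
    simp only [hre]
    have : ∀ r : ℝ, c ^ 2 + a ^ 2 * r ^ 2 ≠ 0 := fun r => (hpos r).ne'
    fun_prop (disch := assumption)

theorem tendsto_integral_mul_one_sub_mul_inv (a τ : ℝ) (h : 0 < 1 - τ * a) :
    Filter.Tendsto
      (fun M : ℝ => ∫ r in (-M)..M, (a : ℂ) * (1 - ((τ : ℂ) + Complex.I * r) * a)⁻¹)
      Filter.atTop (nhds ((π * SignType.sign a : ℝ) : ℂ)) := by
  simp only [integral_mul_one_sub_mul_inv a τ _ h]
  refine (Complex.continuous_ofReal.tendsto _).comp ?_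
  have hb := tendsto_nhds_of_tendsto_nhdsWithin tendsto_arctan_atBot
  have ht := tendsto_nhds_of_tendsto_nhdsWithin tendsto_arctan_atTop
  rcases lt_trichotomy a 0 with ha | ha | ha
  · have hs : π * SignType.sign a = 2 * -(π / 2) := by
      rw [sign_neg ha]
      simp
      ring
    rw [hs]
    exact (hb.comp (Filter.tendsto_id.const_mul_atTop_of_neg
      (div_neg_of_neg_of_pos ha h))).const_mul 2
  · subst ha
    simp
  · have hs : π * SignType.sign a = 2 * (π / 2) := by
      rw [sign_pos ha]
      simp
      ring
    rw [hs]
    exact (ht.comp (Filter.tendsto_id.const_mul_atTop (div_pos ha h))).const_mul 2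

theorem integral_pow_mul_prod_one_sub_mul_inv {ι : Type*} [Fintype ι] [DecidableEq ι] {a : ι → ℝ}
    (ha : Function.Injective a) {τ : ℝ} (hτ : τ ≠ 0) (h : ∀ k, 0 < 1 - τ * a k) {q : ℕ}
    (hq : q + 3 ≤ Fintype.card ι)
    (hwint : MeasureTheory.Integrable fun r : ℝ =>
      ((τ : ℂ) + Complex.I * r) ^ q * ∏ k, (1 - ((τ : ℂ) + Complex.I * r) * a k)⁻¹) :
    ∫ r : ℝ, ((τ : ℂ) + Complex.I * r) ^ q * ∏ k, (1 - ((τ : ℂ) + Complex.I * r) * a k)⁻¹ =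
      ((2 * π * ∑ k, max (a k) 0 ^ (Fintype.card ι - 2 - q) /
        ∏ j ∈ univ.erase k, (a k - a j) : ℝ) : ℂ) := by
  obtain ⟨m, hm⟩ : ∃ m, Fintype.card ι - 2 - q = m + 1 :=
    ⟨Fintype.card ι - 3 - q, by omega⟩
  have hm' : Fintype.card ι - 1 - q = m + 1 + 1 := by omega
  have hne : ∀ (r : ℝ) k, 1 - ((τ : ℂ) + Complex.I * r) * a k ≠ 0 := fun r k h0 => by
    have := congrArg Complex.re h0
    simp at this
    exact (h k).ne' this
  have hw0 : ∀ r : ℝ, (τ : ℂ) + Complex.I * r ≠ 0 := fun r h0 => by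
    have := congrArg Complex.re h0
    simp at this
    exact hτ this
  have hpf : ∀ r : ℝ, ((τ : ℂ) + Complex.I * r) ^ q *
      ∏ k, (1 - ((τ : ℂ) + Complex.I * r) * a k)⁻¹ =
      ∑ k, ((a k ^ (m + 1) / ∏ j ∈ univ.erase k, (a k - a j) : ℝ) : ℂ) *
        (a k * (1 - ((τ : ℂ) + Complex.I * r) * a k)⁻¹) := fun r => by
    rw [pow_mul_prod_one_sub_mul_inv (a := fun k => (a k : ℂ))
      (Complex.ofReal_injective.comp ha) (hw0 r) (hne r) (by omega), hm']
    refine Finset.sum_congr rfl fun k _ => ?_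
    push_cast
    ring
  have hlim := MeasureTheory.intervalIntegral_tendsto_integral hwint
    Filter.tendsto_neg_atTop_atBot Filter.tendsto_id
  refine tendsto_nhds_unique hlim ?_
  have hcont : ∀ k, Continuous fun r : ℝ =>
      (a k : ℂ) * (1 - ((τ : ℂ) + Complex.I * r) * a k)⁻¹ := fun k => by
    have := fun r => hne r k
    fun_prop (disch := assumption)
  have hsum : Filter.Tendsto (fun M : ℝ => ∑ k,
      ((a k ^ (m + 1) / ∏ j ∈ univ.erase k, (a k - a j) : ℝ) : ℂ) *
        ∫ r in (-M)..M, (a k : ℂ) * (1 - ((τ : ℂ) + Complex.I * r) * a k)⁻¹) Filter.atTop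
      (nhds (∑ k, ((a k ^ (m + 1) / ∏ j ∈ univ.erase k, (a k - a j) : ℝ) : ℂ) *
        ((π * SignType.sign (a k) : ℝ) : ℂ))) :=
    tendsto_finsetSum _ fun k _ =>
      (tendsto_integral_mul_one_sub_mul_inv (a k) τ (h k)).const_mul _
  convert hsum using 2 with M
  · simp only [hpf, id]
    rw [intervalIntegral.integral_finsetSum fun k _ =>
      ((hcont k).const_mul _).intervalIntegrable _ _]
    simp only [intervalIntegral.integral_const_mul]
  · rw [hm]
    have h0 := sum_pow_div_prod_sub_eq_zero ha 0 (m := m + 1) (by omega)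
    simp only [sub_zero] at h0
    have hterm : ∀ k, 2 * π * (max (a k) 0 ^ (m + 1) / ∏ j ∈ univ.erase k, (a k - a j)) =
        a k ^ (m + 1) / (∏ j ∈ univ.erase k, (a k - a j)) * (π * SignType.sign (a k)) +
          π * (a k ^ (m + 1) / ∏ j ∈ univ.erase k, (a k - a j)) := fun k => by
      rcases lt_trichotomy (a k) 0 with hk | hk | hk
      · rw [sign_neg hk, max_eq_right hk.le]
        simp [mul_comm]
      · simp [hk]
      · rw [sign_pos hk, max_eq_left hk.le]
        simp only [SignType.coe_one]
        ring
    rw [Finset.mul_sum, Finset.sum_congr rfl fun k _ => hterm k, Finset.sum_add_distrib,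
      ← Finset.mul_sum, h0]
    push_cast
    ring

theorem norm_prod_sub_prod_le {ι : Type*} (s : Finset ι) (f g : ι → ℂ) (M d : ι → ℝ)
    (hf : ∀ i ∈ s, ‖f i‖ ≤ M i) (hg : ∀ i ∈ s, ‖g i‖ ≤ M i)
    (hd : ∀ i ∈ s, ‖f i - g i‖ ≤ d i * M i) :
    ‖∏ i ∈ s, f i - ∏ i ∈ s, g i‖ ≤ (∑ i ∈ s, d i) * ∏ i ∈ s, M i := by
  classical
  induction s using Finset.induction_on with
  | empty => simp
  | insert a s ha ih =>
    simp only [Finset.forall_mem_insert] at hf hg hd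
    rw [Finset.prod_insert ha, Finset.prod_insert ha, Finset.prod_insert ha, Finset.sum_insert ha]
    have h1 := ih hf.2 hg.2 hd.2
    have hM : 0 ≤ M a := (norm_nonneg _).trans hf.1
    have hgp : ‖∏ i ∈ s, g i‖ ≤ ∏ i ∈ s, M i := by
      rw [norm_prod]
      exact Finset.prod_le_prod (fun i _ => norm_nonneg _) hg.2
    calc ‖f a * ∏ i ∈ s, f i - g a * ∏ i ∈ s, g i‖
        = ‖f a * (∏ i ∈ s, f i - ∏ i ∈ s, g i) + (f a - g a) * ∏ i ∈ s, g i‖ := by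
          congr 1; ring
      _ ≤ ‖f a‖ * ‖∏ i ∈ s, f i - ∏ i ∈ s, g i‖ + ‖f a - g a‖ * ‖∏ i ∈ s, g i‖ := by
          refine (norm_add_le _ _).trans ?_
          rw [norm_mul, norm_mul]
      _ ≤ M a * ((∑ i ∈ s, d i) * ∏ i ∈ s, M i) + (d a * M a) * ∏ i ∈ s, M i := by
          refine add_le_add (mul_le_mul hf.1 h1 (norm_nonneg _) hM)
            (mul_le_mul hd.1 hgp (norm_nonneg _) ((norm_nonneg _).trans hd.1))
      _ = _ := by ring

theorem norm_inv_one_sub_sub_exp_le {u : ℂ} (hu : ‖u‖ ≤ 1 / 2) :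
    ‖(1 - u)⁻¹ - Complex.exp (u + u ^ 2 / 2)‖ ≤ 8 * ‖u‖ ^ 3 := by
  have hu1 : 1 / 2 ≤ ‖1 - u‖ := by
    have := norm_sub_norm_le (1 : ℂ) u
    rw [norm_one] at this
    linarith
  have hne : 1 - u ≠ 0 := norm_pos_iff.mp (by linarith)
  have hy : ‖u + u ^ 2 / 2‖ ≤ 5 / 4 * ‖u‖ := by
    refine (norm_add_le _ _).trans ?_
    rw [norm_div, norm_pow, Complex.norm_ofNat]
    nlinarith [norm_nonneg u]
  have hE := Complex.norm_exp_sub_sum_le_norm_mul_exp (u + u ^ 2 / 2) 3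
  simp only [Finset.sum_range_succ, Finset.sum_range_zero, Nat.factorial] at hE
  have hexp : Real.exp ‖u + u ^ 2 / 2‖ ≤ 2.7182818286 :=
    (Real.exp_le_exp.mpr (by linarith)).trans Real.exp_one_lt_d9.le
  have hE' : ‖u + u ^ 2 / 2‖ ^ 3 * Real.exp ‖u + u ^ 2 / 2‖ ≤ 43 / 8 * ‖u‖ ^ 3 := by
    calc _ ≤ (5 / 4 * ‖u‖) ^ 3 * 2.7182818286 := by gcongr
      _ ≤ _ := by nlinarith [pow_nonneg (norm_nonneg u) 3]
  generalize Complex.exp (u + u ^ 2 / 2) = e at hE ⊢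
  have h3 : ‖u ^ 3 * (1 - u)⁻¹‖ ≤ 2 * ‖u‖ ^ 3 := by
    rw [norm_mul, norm_pow, norm_inv, mul_comm]
    gcongr
    rw [inv_le_comm₀ (by linarith) (by norm_num)]
    linarith
  have h4 : ‖u ^ 3 / 2 + u ^ 4 / 8‖ ≤ 9 / 16 * ‖u‖ ^ 3 := by
    refine (norm_add_le _ _).trans ?_
    rw [norm_div, norm_div, norm_pow, norm_pow, Complex.norm_ofNat, Complex.norm_ofNat,
      pow_succ _ 3]
    nlinarith [pow_nonneg (norm_nonneg u) 3]
  have hsplit : (1 - u)⁻¹ - e = u ^ 3 * (1 - u)⁻¹ - (u ^ 3 / 2 + u ^ 4 / 8) -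
      (e - (0 + (u + u ^ 2 / 2) ^ 0 / ((1 : ℕ) : ℂ) +
        (u + u ^ 2 / 2) ^ 1 / (((0 + 1) * 1 : ℕ) : ℂ) +
        (u + u ^ 2 / 2) ^ 2 / (((1 + 1) * ((0 + 1) * 1) : ℕ) : ℂ))) := by
    have : (1 - u)⁻¹ = 1 + u + u ^ 2 + u ^ 3 * (1 - u)⁻¹ := by
      field_simp
      ring
    push_cast
    linear_combination this
  rw [hsplit]
  refine (norm_sub_le _ _).trans ?_
  have := norm_sub_le (u ^ 3 * (1 - u)⁻¹) (u ^ 3 / 2 + u ^ 4 / 8)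
  linarith [hE.trans hE', pow_nonneg (norm_nonneg u) 3]

theorem exp_neg_sub_sq_le {x : ℝ} (hx : |x| ≤ 1 / 4) : Real.exp (-(x + x ^ 2)) ≤ 1 - x := by
  obtain ⟨h1, h2⟩ := abs_le.mp hx
  rw [Real.exp_neg, inv_le_comm₀ (Real.exp_pos _) (by linarith)]
  rcases le_total 0 x with h | h
  · refine le_trans ?_ (Real.quadratic_le_exp_of_nonneg (by positivity))
    rw [inv_le_iff_one_le_mul₀ (by linarith)]
    nlinarith [mul_nonneg h h, mul_nonneg (mul_nonneg h h) h,
      mul_nonneg (mul_nonneg h h) (sub_nonneg.mpr h2),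
      mul_nonneg (mul_nonneg (mul_nonneg h h) h) (sub_nonneg.mpr h2), pow_nonneg h 4,
      pow_nonneg h 5]
  · refine le_trans ?_ (Real.add_one_le_exp _)
    rw [inv_le_iff_one_le_mul₀ (by linarith)]
    nlinarith [mul_nonneg (sq_nonneg x) (neg_nonneg.mpr h)]

/-- A common majorant of the factors `(1 - w a)⁻¹` and `exp (w a + w² a² / 2)` on the line
`re w = τ = ±1`. -/
noncomputable def factorBound (τ r a : ℝ) : ℝ :=
  Real.exp (τ * a + a ^ 2) * (Real.sqrt (1 + r ^ 2 * a ^ 2 / 2))⁻¹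

theorem norm_inv_one_sub_le_factorBound {τ r a : ℝ} (hτ : τ ^ 2 = 1) (ha : |a| ≤ 1 / 4) :
    ‖(1 - ((τ : ℂ) + Complex.I * r) * a)⁻¹‖ ≤ factorBound τ r a := by
  have hτa : |τ * a| ≤ 1 / 4 := by
    rw [abs_mul, (by nlinarith [sq_abs τ, abs_nonneg τ] : |τ| = 1), one_mul]
    exact ha
  obtain ⟨h1, h2⟩ := abs_le.mp hτa
  have hx := exp_neg_sub_sq_le hτa
  rw [mul_pow, hτ, one_mul, Real.exp_neg] at hx
  have hne : 1 - ((τ : ℂ) + Complex.I * r) * a ≠ 0 := fun h0 => by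
    have := congrArg Complex.re h0
    simp at this
    linarith
  rw [factorBound, norm_inv, inv_le_comm₀ (norm_pos_iff.mpr hne) (by positivity), mul_inv, inv_inv]
  refine le_trans (mul_le_mul_of_nonneg_right hx (Real.sqrt_nonneg _)) ?_
  rw [Complex.norm_eq_sqrt_sq_add_sq]
  refine Real.le_sqrt_of_sq_le ?_
  rw [mul_pow, Real.sq_sqrt (by positivity)]
  simp
  have : (1 - τ * a) ^ 2 ≤ 2 := by nlinarith
  nlinarith [mul_nonneg (sq_nonneg r) (sq_nonneg a)]

theorem norm_exp_le_factorBound {τ r a : ℝ} (hτ : τ ^ 2 = 1) :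
    ‖Complex.exp (((τ : ℂ) + Complex.I * r) * a + (((τ : ℂ) + Complex.I * r) * a) ^ 2 / 2)‖ ≤
      factorBound τ r a := by
  have hre : (((τ : ℂ) + Complex.I * r) * a + (((τ : ℂ) + Complex.I * r) * a) ^ 2 / 2).re =
      τ * a + a ^ 2 / 2 - r ^ 2 * a ^ 2 / 2 := by
    have : (((τ : ℂ) + Complex.I * r) * a + (((τ : ℂ) + Complex.I * r) * a) ^ 2 / 2) =
      ((τ * a + τ ^ 2 * a ^ 2 / 2 - r ^ 2 * a ^ 2 / 2 : ℝ) : ℂ) +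
        ((r * a + τ * r * a ^ 2 : ℝ) : ℂ) * Complex.I := by
      push_cast
      linear_combination (r : ℂ) ^ 2 * a ^ 2 / 2 * Complex.I_sq
    rw [this, hτ, Complex.add_re, Complex.ofReal_re, Complex.re_ofReal_mul, Complex.I_re]
    ring
  rw [Complex.norm_exp, hre, factorBound, sub_eq_add_neg, Real.exp_add, Real.exp_neg]
  have hy : 0 ≤ r ^ 2 * a ^ 2 / 2 := by positivity
  gcongr
  · linarith [sq_nonneg a]
  · refine (Real.sqrt_le_left (by positivity)).mpr ?_
    nlinarith [Real.add_one_le_exp (r ^ 2 * a ^ 2 / 2)]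

theorem norm_inv_one_sub_sub_exp_le_factorBound {τ r a : ℝ} (hτ : τ ^ 2 = 1) (ha : |a| ≤ 1 / 4) :
    ‖(1 - ((τ : ℂ) + Complex.I * r) * a)⁻¹ -
      Complex.exp (((τ : ℂ) + Complex.I * r) * a + (((τ : ℂ) + Complex.I * r) * a) ^ 2 / 2)‖ ≤
      16 * ‖((τ : ℂ) + Complex.I * r) * a‖ ^ 3 * factorBound τ r a := by
  have hM : 0 < factorBound τ r a := by unfold factorBound; positivity
  rcases le_total ‖((τ : ℂ) + Complex.I * r) * a‖ (1 / 2) with hu | hu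
  · refine (norm_inv_one_sub_sub_exp_le hu).trans ?_
    have hsq : ‖((τ : ℂ) + Complex.I * r) * a‖ ^ 2 = (1 + r ^ 2) * a ^ 2 := by
      rw [norm_mul, mul_pow, Complex.norm_real, Real.norm_eq_abs, sq_abs, ← hτ]
      congr 1
      rw [Complex.sq_norm, Complex.normSq_apply]
      simp; ring
    have hra : r ^ 2 * a ^ 2 ≤ 1 / 4 := by nlinarith [norm_nonneg (((τ : ℂ) + Complex.I * r) * a)]
    have hτa : |τ * a| ≤ 1 / 4 := by
      rw [abs_mul, (by nlinarith [sq_abs τ, abs_nonneg τ] : |τ| = 1), one_mul]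
      exact ha
    have hM2 : 1 / 2 ≤ factorBound τ r a := by
      have h1 : 3 / 4 ≤ Real.exp (τ * a + a ^ 2) := by
        linarith [Real.add_one_le_exp (τ * a + a ^ 2), (abs_le.mp hτa).1, sq_nonneg a]
      have h2 : 2 / 3 ≤ (Real.sqrt (1 + r ^ 2 * a ^ 2 / 2))⁻¹ := by
        rw [le_inv_comm₀ (by norm_num) (by positivity)]
        refine Real.sqrt_le_iff.mpr ⟨by norm_num, by linarith⟩
      unfold factorBound
      nlinarith
    nlinarith [pow_nonneg (norm_nonneg (((τ : ℂ) + Complex.I * r) * a)) 3]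
  · refine (norm_sub_le _ _).trans ?_
    have h1 := norm_inv_one_sub_le_factorBound (r := r) hτ ha
    have h2 := norm_exp_le_factorBound (r := r) (a := a) hτ
    have h3 : (1 / 2 : ℝ) ^ 3 ≤ ‖((τ : ℂ) + Complex.I * r) * a‖ ^ 3 := by gcongr
    nlinarith

theorem norm_sq_add_I_mul {τ : ℝ} (hτ : τ ^ 2 = 1) (r : ℝ) :
    ‖(τ : ℂ) + Complex.I * r‖ ^ 2 = 1 + r ^ 2 := by
  rw [Complex.sq_norm, Complex.normSq_apply, ← hτ]
  simp
  ring

theorem norm_add_I_mul_le {τ : ℝ} (hτ : τ ^ 2 = 1) (r : ℝ) :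
    ‖(τ : ℂ) + Complex.I * r‖ ≤ 1 + r ^ 2 := by
  have := norm_sq_add_I_mul hτ r
  nlinarith [norm_nonneg ((τ : ℂ) + Complex.I * r), sq_nonneg r]

theorem prod_factorBound_le {ι : Type*} [Fintype ι] {τ r : ℝ} {a : ι → ℝ} {K : ℕ} (hK : 0 < K)
    (ha : ∀ k, 2 * K * a k ^ 2 ≤ 1) (hsum : 1 ≤ ∑ k, a k ^ 2) :
    ∏ k, factorBound τ r (a k) ≤
      Real.exp (τ * ∑ k, a k + ∑ k, a k ^ 2) * ((4 * K) ^ K * ((1 + r ^ 2) ^ K)⁻¹) := by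
  have hK' : (1 : ℝ) ≤ K := by exact_mod_cast hK
  have hbase : (1 : ℝ) ≤ 1 + r ^ 2 / (4 * K) := by
    have : 0 ≤ r ^ 2 / (4 * K) := by positivity
    linarith
  have hlow : (((1 + r ^ 2) / (4 * K)) ^ K) ^ 2 ≤ ∏ k, (1 + r ^ 2 * a k ^ 2 / 2) := by
    calc (((1 + r ^ 2) / (4 * K)) ^ K) ^ 2 ≤ (1 + r ^ 2 / (4 * K)) ^ (2 * K) := by
          rw [← pow_mul, mul_comm K 2]
          refine pow_le_pow_left₀ (by positivity) ?_ _
          rw [add_div]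
          gcongr
          rw [div_le_one (by positivity)]
          linarith
      _ = (1 + r ^ 2 / (4 * K)) ^ ((2 * K : ℕ) : ℝ) := (Real.rpow_natCast _ _).symm
      _ ≤ (1 + r ^ 2 / (4 * K)) ^ (∑ k, 2 * K * a k ^ 2) := by
          refine Real.rpow_le_rpow_of_exponent_le hbase ?_
          rw [← Finset.mul_sum]
          push_cast
          nlinarith
      _ = ∏ k, (1 + r ^ 2 / (4 * K)) ^ (2 * K * a k ^ 2) :=
          Real.rpow_sum_of_pos (by linarith) _ _
      _ ≤ ∏ k, (1 + r ^ 2 * a k ^ 2 / 2) := by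
          refine Finset.prod_le_prod (fun k _ => by positivity) fun k _ => ?_
          refine (rpow_one_add_le_one_add_mul_self (by linarith) (by positivity) (ha k)).trans
            (le_of_eq ?_)
          field_simp
          ring
  have hsq : (((1 + r ^ 2) / (4 * K)) ^ K) ≤ Real.sqrt (∏ k, (1 + r ^ 2 * a k ^ 2 / 2)) :=
    Real.le_sqrt_of_sq_le hlow
  have hprod : ∏ k, factorBound τ r (a k) = Real.exp (τ * ∑ k, a k + ∑ k, a k ^ 2) *
      (Real.sqrt (∏ k, (1 + r ^ 2 * a k ^ 2 / 2)))⁻¹ := by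
    simp only [factorBound, Finset.prod_mul_distrib, ← Real.exp_sum, Finset.sum_add_distrib,
      Finset.mul_sum, Finset.prod_inv_distrib]
    rw [Real.sqrt_prod _ fun k _ => by positivity]
  rw [hprod]
  gcongr
  refine (inv_anti₀ (by positivity) hsq).trans (le_of_eq ?_)
  rw [div_pow, inv_div, div_eq_mul_inv]

theorem norm_prod_inv_one_sub_sub_exp_le {ι : Type*} [Fintype ι] {τ : ℝ} (hτ : τ ^ 2 = 1) (r : ℝ)
    {a : ι → ℝ} {K : ℕ} (hK : 8 ≤ K) (ha : ∀ k, 2 * K * a k ^ 2 ≤ 1) (hsum : 1 ≤ ∑ k, a k ^ 2) :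
    ‖∏ k, (1 - ((τ : ℂ) + Complex.I * r) * a k)⁻¹ -
      Complex.exp (((τ : ℂ) + Complex.I * r) * (∑ k, a k : ℝ) +
        ((τ : ℂ) + Complex.I * r) ^ 2 * (∑ k, a k ^ 2 : ℝ) / 2)‖ ≤
      16 * ‖(τ : ℂ) + Complex.I * r‖ ^ 3 * (∑ k, |a k| ^ 3) *
        (Real.exp (τ * ∑ k, a k + ∑ k, a k ^ 2) * ((4 * K) ^ K * ((1 + r ^ 2) ^ K)⁻¹)) := by
  have hK' : (8 : ℝ) ≤ K := by exact_mod_cast hK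
  have ha' : ∀ k, |a k| ≤ 1 / 4 := fun k =>
    abs_le_of_sq_le_sq (by nlinarith [ha k, sq_nonneg (a k)]) (by norm_num)
  have h := norm_prod_sub_prod_le univ
    (fun k => (1 - ((τ : ℂ) + Complex.I * r) * a k)⁻¹)
    (fun k => Complex.exp (((τ : ℂ) + Complex.I * r) * a k +
      (((τ : ℂ) + Complex.I * r) * a k) ^ 2 / 2))
    (fun k => factorBound τ r (a k)) (fun k => 16 * ‖((τ : ℂ) + Complex.I * r) * a k‖ ^ 3)
    (fun k _ => norm_inv_one_sub_le_factorBound hτ (ha' k))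
    (fun k _ => norm_exp_le_factorBound hτ)
    (fun k _ => norm_inv_one_sub_sub_exp_le_factorBound hτ (ha' k))
  have hexp : ∏ k, Complex.exp (((τ : ℂ) + Complex.I * r) * a k +
      (((τ : ℂ) + Complex.I * r) * a k) ^ 2 / 2) =
      Complex.exp (((τ : ℂ) + Complex.I * r) * (∑ k, a k : ℝ) +
        ((τ : ℂ) + Complex.I * r) ^ 2 * (∑ k, a k ^ 2 : ℝ) / 2) := by
    rw [← Complex.exp_sum, Finset.sum_add_distrib]
    push_cast
    rw [Finset.mul_sum, Finset.mul_sum, Finset.sum_div]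
    simp only [mul_pow]
  have hd : ∑ k, 16 * ‖((τ : ℂ) + Complex.I * r) * a k‖ ^ 3 =
      16 * ‖(τ : ℂ) + Complex.I * r‖ ^ 3 * ∑ k, |a k| ^ 3 := by
    rw [Finset.mul_sum]
    refine Finset.sum_congr rfl fun k _ => ?_
    rw [norm_mul, mul_pow, Complex.norm_real, Real.norm_eq_abs]
    ring
  rw [hexp, hd] at h
  exact h.trans (mul_le_mul_of_nonneg_left (prod_factorBound_le (by omega) ha hsum)
    (by positivity))

theorem norm_exp_sub_one_le_of_re_le {z : ℂ} {c : ℝ} (hc : 0 ≤ c) (hz : z.re ≤ c) :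
    ‖Complex.exp z - 1‖ ≤ Real.exp c * ‖z‖ := by
  have h := Convex.norm_image_sub_le_of_norm_hasDerivWithin_le (f := Complex.exp)
    (f' := Complex.exp) (s := {u : ℂ | u.re ≤ c}) (C := Real.exp c) (x := 0) (y := z)
    (fun u _ => (Complex.hasDerivAt_exp u).hasDerivWithinAt)
    (fun u hu => by rw [Complex.norm_exp]; exact Real.exp_le_exp.mpr hu)
    (convex_halfSpace_re_le c) (by simpa using hc) hz
  simpa using h

theorem exp_half_one_sub_sq_le (r : ℝ) (k : ℕ) :
    Real.exp ((1 - r ^ 2) / 2) ≤ Real.exp 1 * k.factorial * 2 ^ k * ((1 + r ^ 2) ^ k)⁻¹ := by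
  have h := Real.pow_div_factorial_le_exp ((1 + r ^ 2) / 2) (by positivity) k
  have h1 : Real.exp ((1 - r ^ 2) / 2) = Real.exp 1 * (Real.exp ((1 + r ^ 2) / 2))⁻¹ := by
    rw [← Real.exp_neg, ← Real.exp_add]
    congr 1
    ring
  rw [h1]
  simp only [mul_assoc]
  gcongr
  refine (inv_anti₀ (by positivity) h).trans (le_of_eq ?_)
  rw [div_pow]
  field_simp

theorem norm_exp_neg_mul_add_sq_div {τ : ℝ} (hτ : τ ^ 2 = 1) (r t : ℝ) :
    ‖Complex.exp (-((τ : ℂ) + Complex.I * r) * t + ((τ : ℂ) + Complex.I * r) ^ 2 / 2)‖ =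
      Real.exp (-(τ * t)) * Real.exp ((1 - r ^ 2) / 2) := by
  have : -((τ : ℂ) + Complex.I * r) * t + ((τ : ℂ) + Complex.I * r) ^ 2 / 2 =
      ((-(τ * t) + (τ ^ 2 - r ^ 2) / 2 : ℝ) : ℂ) + ((-(r * t) + τ * r : ℝ) : ℂ) * Complex.I := by
    push_cast
    linear_combination (r : ℂ) ^ 2 / 2 * Complex.I_sq
  rw [Complex.norm_exp, this, hτ, Complex.add_re, Complex.ofReal_re, Complex.re_ofReal_mul,
    Complex.I_re, mul_zero, add_zero, Real.exp_add]

theorem norm_pow_mul_exp_neg_mul_add_sq_div_le {τ : ℝ} (hτ : τ ^ 2 = 1) (q : ℕ) (r t : ℝ) :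
    ‖(-((τ : ℂ) + Complex.I * r)) ^ q *
      Complex.exp (-((τ : ℂ) + Complex.I * r) * t + ((τ : ℂ) + Complex.I * r) ^ 2 / 2)‖ ≤
      Real.exp 1 * (q + 1).factorial * 2 ^ (q + 1) * Real.exp (-(τ * t)) * (1 + r ^ 2)⁻¹ := by
  rw [norm_mul, norm_exp_neg_mul_add_sq_div hτ, norm_pow, norm_neg]
  calc _ ≤ (1 + r ^ 2) ^ q * (Real.exp (-(τ * t)) *
        (Real.exp 1 * (q + 1).factorial * 2 ^ (q + 1) * ((1 + r ^ 2) ^ (q + 1))⁻¹)) := by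
        gcongr
        · exact norm_add_I_mul_le hτ r
        · exact exp_half_one_sub_sq_le r (q + 1)
    _ = _ := by
        have : 1 + r ^ 2 ≠ 0 := by positivity
        field_simp
        ring

theorem integrable_pow_mul_exp_neg_mul_add_sq_div {τ : ℝ} (hτ : τ ^ 2 = 1) (q : ℕ) (t : ℝ) :
    MeasureTheory.Integrable fun r : ℝ => (-((τ : ℂ) + Complex.I * r)) ^ q *
      Complex.exp (-((τ : ℂ) + Complex.I * r) * t + ((τ : ℂ) + Complex.I * r) ^ 2 / 2) :=
  (integrable_inv_one_add_sq.const_mul _).mono' (by fun_prop)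
    (Filter.Eventually.of_forall fun r => norm_pow_mul_exp_neg_mul_add_sq_div_le hτ q r t)

theorem hasDerivAt_integral_pow_mul_exp {τ : ℝ} (hτ : τ ^ 2 = 1) (q : ℕ) (t : ℝ) :
    HasDerivAt (fun t : ℝ => ∫ r : ℝ, (-((τ : ℂ) + Complex.I * r)) ^ q *
        Complex.exp (-((τ : ℂ) + Complex.I * r) * t + ((τ : ℂ) + Complex.I * r) ^ 2 / 2))
      (∫ r : ℝ, (-((τ : ℂ) + Complex.I * r)) ^ (q + 1) *
        Complex.exp (-((τ : ℂ) + Complex.I * r) * t + ((τ : ℂ) + Complex.I * r) ^ 2 / 2)) t := by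
  refine (hasDerivAt_integral_of_dominated_loc_of_deriv_le (Metric.ball_mem_nhds t one_pos)
    (F' := fun (t r : ℝ) => (-((τ : ℂ) + Complex.I * r)) ^ (q + 1) *
        Complex.exp (-((τ : ℂ) + Complex.I * r) * t + ((τ : ℂ) + Complex.I * r) ^ 2 / 2))
    (bound := fun r => Real.exp 1 * (q + 1 + 1).factorial * 2 ^ (q + 1 + 1) *
      Real.exp (|t| + 1) * (1 + r ^ 2)⁻¹)
    (Filter.Eventually.of_forall fun s => by fun_prop)
    (integrable_pow_mul_exp_neg_mul_add_sq_div hτ q t) (by fun_prop)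
    (Filter.Eventually.of_forall fun r s hs => ?_) (integrable_inv_one_add_sq.const_mul _)
    (Filter.Eventually.of_forall fun r s _ => ?_)).2
  · refine (norm_pow_mul_exp_neg_mul_add_sq_div_le hτ (q + 1) r s).trans ?_
    gcongr
    rw [Metric.mem_ball, Real.dist_eq] at hs
    have hτ1 : |τ| = 1 := by nlinarith [sq_abs τ, abs_nonneg τ]
    calc -(τ * s) ≤ |τ * s| := neg_le_abs _
      _ = |s| := by rw [abs_mul, hτ1, one_mul]
      _ ≤ |t| + 1 := by linarith [abs_sub_abs_le_abs_sub s t]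
  · have h1 : HasDerivAt (fun s : ℝ => -((τ : ℂ) + Complex.I * r) * (s : ℂ) +
        ((τ : ℂ) + Complex.I * r) ^ 2 / 2) (-((τ : ℂ) + Complex.I * r)) s := by
      simpa using ((hasDerivAt_id' s).ofReal_comp.const_mul (-((τ : ℂ) + Complex.I * r))).add_const
        (((τ : ℂ) + Complex.I * r) ^ 2 / 2)
    refine (h1.cexp.const_mul ((-((τ : ℂ) + Complex.I * r)) ^ q)).congr_deriv ?_
    ring

theorem integral_exp_neg_mul_add_sq_div (τ t : ℝ) :
    ∫ r : ℝ, Complex.exp (-((τ : ℂ) + Complex.I * r) * t + ((τ : ℂ) + Complex.I * r) ^ 2 / 2) =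
      ((Real.sqrt (2 * π) * Real.exp (-t ^ 2 / 2) : ℝ) : ℂ) := by
  have h := integral_cexp_quadratic (b := -1 / 2) (by norm_num) (Complex.I * (τ - t))
    (τ ^ 2 / 2 - τ * t)
  have h1 : ∀ r : ℝ, -((τ : ℂ) + Complex.I * r) * t + ((τ : ℂ) + Complex.I * r) ^ 2 / 2 =
      -1 / 2 * r ^ 2 + Complex.I * (τ - t) * r + (τ ^ 2 / 2 - τ * t) := fun r => by
    linear_combination (r : ℂ) ^ 2 / 2 * Complex.I_sq
  simp only [h1]
  rw [h]
  have h2 : ((π : ℂ) / -(-1 / 2)) = ((2 * π : ℝ) : ℂ) := by push_cast; ring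
  have h3 : (τ : ℂ) ^ 2 / 2 - τ * t - (Complex.I * (τ - t)) ^ 2 / (4 * (-1 / 2)) =
      ((-t ^ 2 / 2 : ℝ) : ℂ) := by
    push_cast
    linear_combination ((τ : ℂ) - t) ^ 2 / 2 * Complex.I_sq
  have h4 : ((2 * π : ℝ) : ℂ) ^ (1 / 2 : ℂ) = ((Real.sqrt (2 * π) : ℝ) : ℂ) := by
    rw [Real.sqrt_eq_rpow, Complex.ofReal_cpow (by positivity)]
    norm_num
  rw [h2, h3, h4, Complex.ofReal_mul, Complex.ofReal_exp]

theorem iteratedDeriv_eq_of_forall_hasDerivAt {F : ℕ → ℝ → ℝ} {q : ℕ}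
    (h : ∀ k < q, ∀ t, HasDerivAt (F k) (F (k + 1) t) t) : iteratedDeriv q (F 0) = F q := by
  induction q with
  | zero => exact iteratedDeriv_zero
  | succ q ih =>
    rw [iteratedDeriv_succ, ih fun k hk => h k (hk.trans q.lt_succ_self)]
    exact funext fun t => (h q q.lt_succ_self t).deriv

theorem hasDerivAt_max_zero_pow (m : ℕ) (y : ℝ) :
    HasDerivAt (fun y : ℝ => max y 0 ^ (m + 2)) ((m + 2) * max y 0 ^ (m + 1)) y := by
  rcases lt_trichotomy y 0 with hy | rfl | hy
  · rw [max_eq_right hy.le, zero_pow (by omega), mul_zero]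
    refine (hasDerivAt_const y (0 : ℝ)).congr_of_eventuallyEq ?_
    filter_upwards [gt_mem_nhds hy] with z hz
    rw [max_eq_right hz.le, zero_pow (by omega)]
  · rw [hasDerivAt_iff_tendsto_slope_zero]
    have hc : Continuous fun y : ℝ => max y 0 ^ (m + 1) := by fun_prop
    have h0 := (hc.tendsto 0).mono_left (nhdsWithin_le_nhds (s := {0}ᶜ))
    simp only [max_self, zero_pow (Nat.succ_ne_zero m), mul_zero] at h0 ⊢
    refine h0.congr' ?_
    filter_upwards [self_mem_nhdsWithin] with z hz
    have hz' : z ≠ 0 := hz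
    rcases le_total z 0 with h | h
    · simp [max_eq_right h]
    · simp only [zero_add, max_eq_left h, smul_eq_mul]
      rw [zero_pow (by omega), sub_zero, pow_succ _ (m + 1)]
      field_simp
  · rw [max_eq_left hy.le]
    refine (((hasDerivAt_pow (m + 2) y).congr_deriv ?_)).congr_of_eventuallyEq ?_
    · push_cast
      rfl
    · filter_upwards [lt_mem_nhds hy] with z hz
      rw [max_eq_left hz.le]

theorem hasDerivAt_bspline {n : ℕ} (x : Fin n → ℝ) {q : ℕ} (hq : q + 4 ≤ n) (t : ℝ) :
    HasDerivAt
      (fun s : ℝ => (-1) ^ q * ((n - 2).descFactorial q / (n : ℝ) ^ q) *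
        ∑ k, max (x k - s / n) 0 ^ (n - 2 - q) / ∏ j ∈ univ.erase k, (x k - x j))
      ((-1) ^ (q + 1) * ((n - 2).descFactorial (q + 1) / (n : ℝ) ^ (q + 1)) *
        ∑ k, max (x k - t / n) 0 ^ (n - 2 - (q + 1)) / ∏ j ∈ univ.erase k, (x k - x j)) t := by
  obtain ⟨m, hm⟩ : ∃ m, n - 2 - q = m + 2 := ⟨n - 4 - q, by omega⟩
  have hm' : n - 2 - (q + 1) = m + 1 := by omega
  have hn : (n : ℝ) ≠ 0 := by
    have : n ≠ 0 := by omega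
    exact_mod_cast this
  rw [Nat.descFactorial_succ, hm, hm']
  have hk : ∀ k, HasDerivAt
      (fun s : ℝ => max (x k - s / n) 0 ^ (m + 2) / ∏ j ∈ univ.erase k, (x k - x j))
      ((m + 2) * max (x k - t / n) 0 ^ (m + 1) * -(1 / n) / ∏ j ∈ univ.erase k, (x k - x j))
      t := fun k =>
    ((hasDerivAt_max_zero_pow m (x k - t / n)).comp t
      (((hasDerivAt_id' t).div_const (n : ℝ)).const_sub (x k))).div_const _
  refine ((HasDerivAt.fun_sum fun k _ => hk k).const_mul _).congr_deriv ?_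
  rw [Finset.mul_sum, Finset.mul_sum]
  refine Finset.sum_congr rfl fun k _ => ?_
  push_cast
  field_simp
  ring

theorem inv_le_sum_abs_pow_three {n : ℕ} (hn : 8 ≤ n) {x : Fin n → ℝ} (h : ∑ k, x k ^ 2 = 1) :
    1 / (n : ℝ) ≤ ∑ k, |x k| ^ 3 := by
  have hn' : (8 : ℝ) ≤ n := by exact_mod_cast hn
  have hk : ∀ k, x k ^ 2 ≤ n / 2 * |x k| ^ 3 + 4 / (n : ℝ) ^ 2 := fun k => by
    rw [← sq_abs (x k)]
    generalize |x k| = y, abs_nonneg (x k) = hy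
    rcases le_total (2 / (n : ℝ)) y with hc | hc
    · have h1 : 1 ≤ n / 2 * y := by
        rw [div_le_iff₀ (by linarith)] at hc
        linarith
      have : 0 ≤ 4 / (n : ℝ) ^ 2 := by positivity
      nlinarith [sq_nonneg y]
    · have h1 : y ^ 2 ≤ (2 / (n : ℝ)) ^ 2 := by gcongr
      have h2 : 0 ≤ n / 2 * y ^ 3 := by positivity
      have h3 : (2 / (n : ℝ)) ^ 2 = 4 / (n : ℝ) ^ 2 := by ring
      linarith
  have hs := Finset.sum_le_sum fun k (_ : k ∈ univ) => hk k
  rw [h, Finset.sum_add_distrib, ← Finset.mul_sum, Finset.sum_const, Finset.card_univ,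
    Fintype.card_fin, nsmul_eq_mul] at hs
  have h4 : (n : ℝ) * (4 / n ^ 2) = 4 / n := by field_simp
  have h5 : 4 / (n : ℝ) ≤ 1 / 2 := by
    rw [div_le_div_iff₀ (by linarith) (by norm_num)]
    linarith
  rw [div_le_iff₀ (by linarith)]
  linarith

theorem one_sub_descFactorial_div_pow_le {n q : ℕ} (hq : q + 2 ≤ n) :
    1 - ((n - 2).descFactorial q : ℝ) / (n : ℝ) ^ q ≤ q * (q + 1) / n := by
  have hn : (0 : ℝ) < n := by
    have : 0 < n := by omega
    exact_mod_cast this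
  have h1 : ((n - 2 + 1 - q : ℕ) : ℝ) ^ q ≤ (n - 2).descFactorial q := by
    exact_mod_cast Nat.pow_sub_le_descFactorial (n - 2) q
  have h2 : ((n - 2 + 1 - q : ℕ) : ℝ) = n * (1 + -((q + 1) / n)) := by
    rw [show n - 2 + 1 - q = n - (q + 1) by omega, Nat.cast_sub (by omega)]
    field_simp
    push_cast
    ring
  have h3 : ((q : ℝ) + 1) / n ≤ 1 := by
    rw [div_le_one hn]
    exact_mod_cast (by omega : q + 1 ≤ n)
  have h4 := one_add_mul_le_pow (a := -(((q : ℝ) + 1) / n)) (by linarith) q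
  rw [h2, mul_pow] at h1
  have h5 : 1 + (q : ℝ) * -((q + 1) / n) ≤ ((n - 2).descFactorial q : ℝ) / (n : ℝ) ^ q := by
    rw [le_div_iff₀ (by positivity)]
    nlinarith [pow_pos hn q]
  have h6 : (q : ℝ) * -((q + 1) / n) = -(q * (q + 1) / n) := by ring
  linarith

theorem descFactorial_div_pow_le_one (n q : ℕ) :
    ((n - 2).descFactorial q : ℝ) / (n : ℝ) ^ q ≤ 1 := by
  refine div_le_one_of_le₀ ?_ (by positivity)
  exact_mod_cast (Nat.descFactorial_le_pow _ _).trans (Nat.pow_le_pow_left (Nat.sub_le _ _) _)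

theorem norm_pow_mul_prod_sub_exp_le {q n : ℕ} (hn : 8 ≤ n) {x : Fin n → ℝ} (h0 : ∑ k, x k = 0)
    (h2 : ∑ k, x k ^ 2 = 1) (hx : ∀ k, |x k| ≤ 1 / (4 * (q + 12 : ℕ))) {t τ : ℝ}
    (ht : |t / n| ≤ 1 / (4 * (q + 12 : ℕ))) (hτ : τ ^ 2 = 1) (hτt : τ * t = |t|) (r : ℝ) :
    ‖(-((τ : ℂ) + Complex.I * r)) ^ q *
        (∏ k, (1 - ((τ : ℂ) + Complex.I * r) * (x k - t / n : ℝ))⁻¹ -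
          Complex.exp (-((τ : ℂ) + Complex.I * r) * t + ((τ : ℂ) + Complex.I * r) ^ 2 / 2))‖ ≤
      (64 * Real.exp 1 * (4 * (q + 12 : ℕ)) ^ (q + 12) +
          Real.exp 1 * (q + 3).factorial * 2 ^ (q + 3)) *
        ((∑ k, |x k| ^ 3) * (1 + |t| ^ 3) * Real.exp (-|t| / 2)) * (1 + r ^ 2)⁻¹ := by
  set K : ℕ := q + 12 with hK
  set δ := ∑ k, |x k| ^ 3 with hδ
  have hK12 : (12 : ℝ) ≤ K := by rw [hK]; push_cast; linarith [(Nat.cast_nonneg q : (0 : ℝ) ≤ q)]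
  have hn0 : (8 : ℝ) ≤ n := by exact_mod_cast hn
  have hnδ : 1 / (n : ℝ) ≤ δ := inv_le_sum_abs_pow_three hn h2
  have hδ0 : 0 ≤ δ := (by positivity : (0 : ℝ) ≤ 1 / n).trans hnδ
  have hT : 0 ≤ |t| := abs_nonneg t
  have ht2 : t ^ 2 / n ≤ |t| / 8 := by
    have h1 : |t| / n ≤ 1 / 8 := by
      rw [abs_div, Nat.abs_cast] at ht
      refine ht.trans ?_
      rw [div_le_div_iff₀ (by linarith) (by norm_num)]
      linarith
    rw [← sq_abs]
    calc |t| ^ 2 / n = |t| * (|t| / n) := by ring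
      _ ≤ |t| * (1 / 8) := by gcongr
      _ = _ := by ring
  have hsum : ∑ k, (x k - t / n) = -t := by
    rw [Finset.sum_sub_distrib, h0, Finset.sum_const, Finset.card_univ, Fintype.card_fin,
      nsmul_eq_mul]
    field_simp
    ring
  have hsum2 : ∑ k, (x k - t / n) ^ 2 = 1 + t ^ 2 / n := by
    have : ∀ k, (x k - t / n) ^ 2 = x k ^ 2 - 2 * (t / n) * x k + (t / n) ^ 2 := fun k => by ring
    simp only [this]
    rw [Finset.sum_add_distrib, Finset.sum_sub_distrib, h2, ← Finset.mul_sum, h0, Finset.sum_const,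
      Finset.card_univ, Fintype.card_fin, nsmul_eq_mul]
    field_simp
    ring
  have hsum3 : ∑ k, |x k - t / n| ^ 3 ≤ 4 * (δ * (1 + |t| ^ 3)) := by
    have hk : ∀ k ∈ univ, |x k - t / n| ^ 3 ≤ 4 * |x k| ^ 3 + 4 * |t / n| ^ 3 := fun k _ => by
      have h1 := add_pow_le (abs_nonneg (x k)) (abs_nonneg (t / n)) 3
      have h3 : |x k - t / n| ^ 3 ≤ (|x k| + |t / n|) ^ 3 := by
        gcongr
        exact abs_sub _ _
      norm_num at h1
      linarith
    refine (Finset.sum_le_sum hk).trans ?_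
    rw [Finset.sum_add_distrib, ← Finset.mul_sum, ← hδ, Finset.sum_const, Finset.card_univ,
      Fintype.card_fin, nsmul_eq_mul, abs_div, Nat.abs_cast]
    have h1 : (n : ℝ) * (4 * (|t| / n) ^ 3) = 4 * |t| ^ 3 * (1 / n) * (1 / n) := by field_simp
    have h3 : 1 / (n : ℝ) ≤ 1 := by
      rw [div_le_one (by linarith)]
      linarith
    have h4 : 4 * |t| ^ 3 * (1 / (n : ℝ)) * (1 / n) ≤ 4 * |t| ^ 3 * δ * 1 := by gcongr
    linarith
  have ha : ∀ k, 2 * K * (x k - t / n) ^ 2 ≤ 1 := fun k => by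
    have h1 : |x k - t / n| ≤ 1 / (2 * K) := by
      refine (abs_sub _ _).trans ((add_le_add (hx k) ht).trans (le_of_eq ?_))
      field_simp
      norm_num
    have h3 : (x k - t / n) ^ 2 ≤ (1 / (2 * K)) ^ 2 := by
      rw [← sq_abs]
      gcongr
    calc 2 * (K : ℝ) * (x k - t / n) ^ 2 ≤ 2 * (K : ℝ) * (1 / (2 * (K : ℝ))) ^ 2 := by gcongr
      _ = 1 / (2 * (K : ℝ)) := by field_simp
      _ ≤ 1 := by
        rw [div_le_one (by linarith)]
        linarith
  have hmain := norm_prod_inv_one_sub_sub_exp_le hτ r (K := K) (by omega) ha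
    (by rw [hsum2]; linarith [(by positivity : 0 ≤ t ^ 2 / n)])
  rw [hsum, hsum2, mul_neg, hτt] at hmain
  have hw := norm_add_I_mul_le hτ r
  have hw2 := norm_sq_add_I_mul hτ r
  have hQ := norm_exp_neg_mul_add_sq_div hτ r t
  rw [hτt] at hQ
  set w : ℂ := (τ : ℂ) + Complex.I * r with hwdef
  set P := ∏ k, (1 - w * (x k - t / n : ℝ))⁻¹ with hP
  set Q := Complex.exp (-w * t + w ^ 2 / 2) with hQdef
  have hr : (1 : ℝ) ≤ 1 + r ^ 2 := by linarith [sq_nonneg r]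
  have hsplit : Complex.exp (w * (-t : ℝ) + w ^ 2 * (1 + t ^ 2 / n : ℝ) / 2) =
      Q * Complex.exp (w ^ 2 * (t ^ 2 / (2 * n) : ℝ)) := by
    rw [hQdef, ← Complex.exp_add]
    congr 1
    push_cast
    ring
  have hcor : ‖Complex.exp (w ^ 2 * (t ^ 2 / (2 * n) : ℝ)) - 1‖ ≤
      Real.exp (|t| / 16) * ((1 + r ^ 2) * (δ * (1 + |t| ^ 3))) := by
    have hre : (w ^ 2).re ≤ 1 := by
      rw [hwdef, sq]
      simp
      nlinarith [sq_nonneg r]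
    have ht2' : t ^ 2 / (2 * n) ≤ |t| / 16 := by
      have : t ^ 2 / (2 * n) = t ^ 2 / n / 2 := by field_simp
      linarith
    have hc0 : 0 ≤ t ^ 2 / (2 * n) := by positivity
    refine (norm_exp_sub_one_le_of_re_le (c := |t| / 16) (by positivity) ?_).trans ?_
    · rw [Complex.re_mul_ofReal]
      nlinarith
    · rw [norm_mul, norm_pow, hw2, Complex.norm_real, Real.norm_eq_abs, abs_of_nonneg hc0]
      gcongr
      have h1 : t ^ 2 / (2 * n) = |t| ^ 2 / 2 * (1 / n) := by rw [sq_abs]; field_simp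
      rw [h1, mul_comm δ]
      gcongr
      nlinarith [mul_nonneg hT (sq_nonneg (|t| - 1)), sq_nonneg (|t| - 1)]
  have hfirst : ‖w‖ ^ q * ‖P - Q * Complex.exp (w ^ 2 * (t ^ 2 / (2 * n) : ℝ))‖ ≤
      64 * Real.exp 1 * (4 * K) ^ K * (δ * (1 + |t| ^ 3) * Real.exp (-|t| / 2)) *
        (1 + r ^ 2)⁻¹ := by
    rw [hsplit] at hmain
    have he : Real.exp (-|t| + (1 + t ^ 2 / n)) ≤ Real.exp 1 * Real.exp (-|t| / 2) := by
      rw [← Real.exp_add]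
      exact Real.exp_le_exp.mpr (by linarith)
    have hpow : ‖w‖ ^ (q + 3) * ((1 + r ^ 2) ^ K)⁻¹ ≤ (1 + r ^ 2)⁻¹ := by
      calc ‖w‖ ^ (q + 3) * ((1 + r ^ 2) ^ K)⁻¹
          ≤ (1 + r ^ 2) ^ (q + 11) * ((1 + r ^ 2) ^ K)⁻¹ := by
            gcongr
            exact (pow_le_pow_left₀ (norm_nonneg _) hw _).trans
              (pow_le_pow_right₀ hr (by omega))
        _ = _ := by
            rw [hK, pow_succ _ (q + 11)]
            field_simp
    calc _ ≤ ‖w‖ ^ q * (16 * ‖w‖ ^ 3 * (4 * (δ * (1 + |t| ^ 3))) *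
          (Real.exp 1 * Real.exp (-|t| / 2) * ((4 * K) ^ K * ((1 + r ^ 2) ^ K)⁻¹))) := by
          gcongr
          refine hmain.trans ?_
          gcongr
      _ = 64 * Real.exp 1 * (4 * K) ^ K * (δ * (1 + |t| ^ 3) * Real.exp (-|t| / 2)) *
          (‖w‖ ^ (q + 3) * ((1 + r ^ 2) ^ K)⁻¹) := by ring
      _ ≤ _ := by gcongr
  have hsecond : ‖w‖ ^ q * ‖Q * (Complex.exp (w ^ 2 * (t ^ 2 / (2 * n) : ℝ)) - 1)‖ ≤
      Real.exp 1 * (q + 3).factorial * 2 ^ (q + 3) *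
        (δ * (1 + |t| ^ 3) * Real.exp (-|t| / 2)) * (1 + r ^ 2)⁻¹ := by
    have he : Real.exp (-|t|) * Real.exp (|t| / 16) ≤ Real.exp (-|t| / 2) := by
      rw [← Real.exp_add]
      gcongr
      linarith
    have hpow : (1 + r ^ 2) ^ (q + 1) * ((1 + r ^ 2) ^ (q + 3))⁻¹ ≤ (1 + r ^ 2)⁻¹ := by
      rw [← div_eq_mul_inv, div_le_iff₀ (by positivity), pow_succ _ (q + 2)]
      field_simp
      exact pow_le_pow_right₀ hr (by omega)
    rw [norm_mul, hQ]
    calc _ ≤ (1 + r ^ 2) ^ q * (Real.exp (-|t|) *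
          (Real.exp 1 * (q + 3).factorial * 2 ^ (q + 3) * ((1 + r ^ 2) ^ (q + 3))⁻¹) *
          (Real.exp (|t| / 16) * ((1 + r ^ 2) * (δ * (1 + |t| ^ 3))))) := by
          gcongr
          exact exp_half_one_sub_sq_le r (q + 3)
      _ = Real.exp 1 * (q + 3).factorial * 2 ^ (q + 3) *
          (δ * (1 + |t| ^ 3) * (Real.exp (-|t|) * Real.exp (|t| / 16))) *
          ((1 + r ^ 2) ^ (q + 1) * ((1 + r ^ 2) ^ (q + 3))⁻¹) := by ring
      _ ≤ _ := by gcongr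
  rw [norm_mul, norm_pow, norm_neg]
  have hdec : P - Q = (P - Q * Complex.exp (w ^ 2 * (t ^ 2 / (2 * n) : ℝ))) +
      Q * (Complex.exp (w ^ 2 * (t ^ 2 / (2 * n) : ℝ)) - 1) := by ring
  rw [hdec]
  calc _ ≤ _ := mul_le_mul_of_nonneg_left (norm_add_le _ _) (by positivity)
    _ ≤ _ := by linarith

theorem norm_integral_le_of_norm_le_inv_one_add_sq {f : ℝ → ℂ} {B : ℝ}
    (h : ∀ r, ‖f r‖ ≤ B * (1 + r ^ 2)⁻¹) : ‖∫ r, f r‖ ≤ B * π := by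
  rw [← integral_univ_inv_one_add_sq, ← MeasureTheory.integral_const_mul]
  exact MeasureTheory.norm_integral_le_of_norm_le (integrable_inv_one_add_sq.const_mul B)
    (Filter.Eventually.of_forall h)

theorem abs_gaussian_sub_bspline_le_of_small {q n : ℕ} (hn : q + 8 ≤ n) {x : Fin n → ℝ}
    (hinj : Function.Injective x) (h0 : ∑ k, x k = 0)
    (h2 : ∑ k, x k ^ 2 = 1) (hx : ∀ k, |x k| ≤ 1 / (4 * (q + 12 : ℕ))) {t τ : ℝ}
    (ht : |t / n| ≤ 1 / (4 * (q + 12 : ℕ))) (hτ : τ ^ 2 = 1) (hτt : τ * t = |t|) :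
    |1 / (2 * π) * (∫ r : ℝ, (-((τ : ℂ) + Complex.I * r)) ^ q *
        Complex.exp (-((τ : ℂ) + Complex.I * r) * t + ((τ : ℂ) + Complex.I * r) ^ 2 / 2)).re -
      (-1) ^ q * ((n - 2).descFactorial q / (n : ℝ) ^ q) *
        ∑ k, max (x k - t / n) 0 ^ (n - 2 - q) / ∏ j ∈ univ.erase k, (x k - x j)| ≤
      (64 * Real.exp 1 * (4 * (q + 12 : ℕ)) ^ (q + 12) +
          Real.exp 1 * (q + 3).factorial * 2 ^ (q + 3) +
          q * (q + 1) * (Real.exp 1 * (q + 1).factorial * 2 ^ (q + 1))) *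
        ((∑ k, |x k| ^ 3) * (1 + |t| ^ 3) * Real.exp (-|t| / 2)) := by
  have hbound := norm_pow_mul_prod_sub_exp_le (by omega : 8 ≤ n) h0 h2 hx ht hτ hτt
  set C₁ := 64 * Real.exp 1 * (4 * (q + 12 : ℕ)) ^ (q + 12) +
    Real.exp 1 * (q + 3).factorial * 2 ^ (q + 3) with hC₁
  set B := Real.exp 1 * (q + 1).factorial * 2 ^ (q + 1) with hB
  set δ := ∑ k, |x k| ^ 3 with hδ
  have hnδ : 1 / (n : ℝ) ≤ δ := inv_le_sum_abs_pow_three (by omega) h2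
  have hδ0 : 0 ≤ δ := (by positivity : (0 : ℝ) ≤ 1 / n).trans hnδ
  set M := δ * (1 + |t| ^ 3) * Real.exp (-|t| / 2) with hM
  set κ := ((n - 2).descFactorial q : ℝ) / (n : ℝ) ^ q with hκ
  have hM0 : 0 ≤ M := by positivity
  have hκ0 : 0 ≤ κ := by positivity
  have hκ1 : κ ≤ 1 := descFactorial_div_pow_le_one n q
  have hκ2 : 1 - κ ≤ q * (q + 1) * δ := by
    refine (one_sub_descFactorial_div_pow_le (by omega)).trans ?_
    rw [div_eq_mul_one_div]
    gcongr
  set Q : ℝ → ℂ := fun r =>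
    Complex.exp (-((τ : ℂ) + Complex.I * r) * t + ((τ : ℂ) + Complex.I * r) ^ 2 / 2) with hQ
  set P : ℝ → ℂ := fun r =>
    ∏ k, (1 - ((τ : ℂ) + Complex.I * r) * (x k - t / n : ℝ))⁻¹ with hP
  set S := ∑ k, max (x k - t / n) 0 ^ (n - 2 - q) / ∏ j ∈ univ.erase k, (x k - x j) with hS
  have hK : (0 : ℝ) < (q + 12 : ℕ) := by positivity
  have hQint : MeasureTheory.Integrable fun r : ℝ => (-((τ : ℂ) + Complex.I * r)) ^ q * Q r :=
    integrable_pow_mul_exp_neg_mul_add_sq_div hτ q t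
  have hdint : MeasureTheory.Integrable fun r : ℝ =>
      (-((τ : ℂ) + Complex.I * r)) ^ q * (P r - Q r) :=
    (integrable_inv_one_add_sq.const_mul _).mono'
      (Measurable.aestronglyMeasurable (by fun_prop)) (Filter.Eventually.of_forall hbound)
  have hPint : MeasureTheory.Integrable fun r : ℝ => (-((τ : ℂ) + Complex.I * r)) ^ q * P r := by
    refine (hdint.add hQint).congr (Filter.Eventually.of_forall fun r => ?_)
    simp only [Pi.add_apply]
    ring
  have hneg : ∀ w : ℂ, (-1) ^ q * (-w) ^ q = w ^ q := fun w => by rw [← mul_pow]; ring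
  have hP' : MeasureTheory.Integrable fun r : ℝ => ((τ : ℂ) + Complex.I * r) ^ q * P r := by
    refine (hPint.const_mul ((-1) ^ q)).congr (Filter.Eventually.of_forall fun r => ?_)
    simp only [← hneg ((τ : ℂ) + Complex.I * r)]
    ring
  have hpos : ∀ k, 0 < 1 - τ * (x k - t / n) := fun k => by
    have h1 : |τ * (x k - t / n)| ≤ 1 / (2 * (q + 12 : ℕ)) := by
      rw [abs_mul, (by nlinarith [sq_abs τ, abs_nonneg τ] : |τ| = 1), one_mul]
      refine (abs_sub _ _).trans ((add_le_add (hx k) ht).trans (le_of_eq ?_))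
      field_simp
      norm_num
    have h3 : 1 / (2 * ((q + 12 : ℕ) : ℝ)) < 1 := by
      rw [div_lt_one (by linarith)]
      push_cast
      linarith [(Nat.cast_nonneg q : (0 : ℝ) ≤ q)]
    linarith [le_abs_self (τ * (x k - t / n))]
  have hspline : ∫ r : ℝ, ((τ : ℂ) + Complex.I * r) ^ q * P r = ((2 * π * S : ℝ) : ℂ) := by
    have h := integral_pow_mul_prod_one_sub_mul_inv (a := fun k => x k - t / n)
      (fun i j hij => hinj (by simpa using hij)) (by rintro rfl; norm_num at hτ) hpos
      (q := q) (by rw [Fintype.card_fin]; omega) hP'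
    simpa only [Fintype.card_fin, sub_sub_sub_cancel_right] using h
  have hdiff : (∫ r : ℝ, (-((τ : ℂ) + Complex.I * r)) ^ q * (P r - Q r)) =
      (-1) ^ q * ((2 * π * S : ℝ) : ℂ) - ∫ r : ℝ, (-((τ : ℂ) + Complex.I * r)) ^ q * Q r := by
    rw [← hspline, ← MeasureTheory.integral_const_mul, ← MeasureTheory.integral_sub
      (hP'.const_mul _) hQint]
    congr 1 with r
    have h := hneg (-((τ : ℂ) + Complex.I * r))
    rw [neg_neg] at h
    linear_combination (-P r) * h
  have hdnorm := norm_integral_le_of_norm_le_inv_one_add_sq hbound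
  have hQnorm := norm_integral_le_of_norm_le_inv_one_add_sq
    (norm_pow_mul_exp_neg_mul_add_sq_div_le hτ q · t)
  rw [hτt] at hQnorm
  set J := ∫ r : ℝ, (-((τ : ℂ) + Complex.I * r)) ^ q * Q r with hJ
  set E := ∫ r : ℝ, (-((τ : ℂ) + Complex.I * r)) ^ q * (P r - Q r) with hE
  have hre : E.re = (-1) ^ q * (2 * π * S) - J.re := by
    rw [hdiff, Complex.sub_re, Complex.re_mul_ofReal,
      (by norm_cast : ((-1 : ℂ) ^ q) = (((-1 : ℝ) ^ q : ℝ) : ℂ)), Complex.ofReal_re]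
  have hD : 1 / (2 * π) * J.re - (-1) ^ q * κ * S =
      1 / (2 * π) * ((1 - κ) * J.re - κ * E.re) := by
    rw [hre]
    field_simp
    ring
  have hexp : Real.exp (-|t|) ≤ Real.exp (-|t| / 2) := by
    exact Real.exp_le_exp.mpr (by linarith [abs_nonneg t])
  have hδM : δ * Real.exp (-|t|) ≤ M := by
    rw [hM, mul_assoc]
    refine mul_le_mul_of_nonneg_left (hexp.trans (le_mul_of_one_le_left (by positivity) ?_)) hδ0
    linarith [pow_nonneg (abs_nonneg t) 3]
  have hB0 : 0 ≤ B := by positivity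
  have hC0 : 0 ≤ C₁ := by positivity
  rw [hD, abs_mul, abs_of_pos (by positivity : 0 < 1 / (2 * π))]
  have hin : |(1 - κ) * J.re - κ * E.re| ≤ (C₁ + q * (q + 1) * B) * M * π := by
    calc |(1 - κ) * J.re - κ * E.re| ≤ (1 - κ) * |J.re| + κ * |E.re| := by
          refine (abs_sub _ _).trans (le_of_eq ?_)
          rw [abs_mul, abs_mul, abs_of_nonneg hκ0, abs_of_nonneg (sub_nonneg.mpr hκ1)]
      _ ≤ q * (q + 1) * δ * (B * Real.exp (-|t|) * π) + 1 * (C₁ * M * π) := by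
          gcongr
          · exact (Complex.abs_re_le_norm _).trans hQnorm
          · exact (Complex.abs_re_le_norm _).trans hdnorm
      _ = (q * (q + 1) * B * (δ * Real.exp (-|t|)) + C₁ * M) * π := by ring
      _ ≤ (q * (q + 1) * B * M + C₁ * M) * π := by gcongr
      _ = _ := by ring
  calc _ ≤ 1 / (2 * π) * ((C₁ + q * (q + 1) * B) * M * π) := by gcongr
    _ = (C₁ + q * (q + 1) * B) * M / 2 := by field_simp
    _ ≤ _ := half_le_self (by positivity)

theorem sum_max_sub_zero_pow_div_eq_zero {n m : ℕ} (hm : m ≠ 0) (hmn : m + 2 ≤ n)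
    {x : Fin n → ℝ} (hinj : Function.Injective x) {c : ℝ} (hc : ∀ k, |x k| ≤ |c|) :
    ∑ k, max (x k - c) 0 ^ m / ∏ j ∈ univ.erase k, (x k - x j) = 0 := by
  rcases le_total 0 c with h | h
  · refine Finset.sum_eq_zero fun k _ => ?_
    have := (le_abs_self _).trans (hc k)
    rw [abs_of_nonneg h] at this
    rw [max_eq_right (by linarith), zero_pow hm, zero_div]
  · refine (Finset.sum_congr rfl fun k _ => ?_).trans
      (sum_pow_div_prod_sub_eq_zero hinj c (m := m) (by simpa using hmn))
    have := (neg_abs_le _).trans' (neg_le_neg (hc k))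
    rw [abs_of_nonpos h] at this
    rw [max_eq_left (by linarith)]

theorem abs_gaussian_sub_bspline_le_of_large {q n : ℕ} (hn : q + 8 ≤ n) {x : Fin n → ℝ}
    (hinj : Function.Injective x) (h2 : ∑ k, x k ^ 2 = 1)
    (hx : ∀ k, |x k| ≤ 1 / (4 * (q + 12 : ℕ))) {t τ : ℝ}
    (ht : 1 / (4 * (q + 12 : ℕ)) ≤ |t / n|) (hτ : τ ^ 2 = 1) (hτt : τ * t = |t|) :
    |1 / (2 * π) * (∫ r : ℝ, (-((τ : ℂ) + Complex.I * r)) ^ q *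
        Complex.exp (-((τ : ℂ) + Complex.I * r) * t + ((τ : ℂ) + Complex.I * r) ^ 2 / 2)).re -
      (-1) ^ q * ((n - 2).descFactorial q / (n : ℝ) ^ q) *
        ∑ k, max (x k - t / n) 0 ^ (n - 2 - q) / ∏ j ∈ univ.erase k, (x k - x j)| ≤
      4 * (q + 12 : ℕ) * (Real.exp 1 * (q + 1).factorial * 2 ^ (q + 1)) *
        ((∑ k, |x k| ^ 3) * (1 + |t| ^ 3) * Real.exp (-|t| / 2)) := by
  rw [sum_max_sub_zero_pow_div_eq_zero (by omega) (by omega) hinj fun k => (hx k).trans ht,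
    mul_zero, sub_zero]
  have hQnorm := norm_integral_le_of_norm_le_inv_one_add_sq
    (norm_pow_mul_exp_neg_mul_add_sq_div_le hτ q · t)
  rw [hτt] at hQnorm
  set B := Real.exp 1 * (q + 1).factorial * 2 ^ (q + 1) with hB
  set δ := ∑ k, |x k| ^ 3 with hδ
  have hnδ : 1 / (n : ℝ) ≤ δ := inv_le_sum_abs_pow_three (by omega) h2
  have hT : 0 ≤ |t| := abs_nonneg t
  have hB0 : 0 ≤ B := by positivity
  have hone : 1 ≤ 4 * (q + 12 : ℕ) * (δ * (1 + |t| ^ 3)) := by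
    rw [div_le_iff₀ (by positivity), abs_div, Nat.abs_cast] at ht
    calc (1 : ℝ) ≤ |t| / n * (4 * (q + 12 : ℕ)) := ht
      _ = 4 * (q + 12 : ℕ) * (1 / n * |t|) := by ring
      _ ≤ _ := by
        gcongr
        nlinarith [mul_nonneg hT (sq_nonneg (|t| - 1)), sq_nonneg (|t| - 1)]
  rw [abs_mul, abs_of_pos (by positivity : 0 < 1 / (2 * π))]
  calc _ ≤ 1 / (2 * π) * (B * Real.exp (-|t|) * π) := by
        gcongr
        exact (Complex.abs_re_le_norm _).trans hQnorm
    _ = B * Real.exp (-|t|) / 2 := by field_simp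
    _ ≤ B * Real.exp (-|t|) := half_le_self (by positivity)
    _ ≤ B * Real.exp (-|t| / 2) * 1 := by
        rw [mul_one]
        gcongr
        linarith
    _ ≤ B * Real.exp (-|t| / 2) * (4 * (q + 12 : ℕ) * (δ * (1 + |t| ^ 3))) := by gcongr
    _ = _ := by ring

theorem abs_pow_mul_one_add_pow_three_mul_exp_le (p : ℕ) (t : ℝ) :
    |t| ^ p * ((1 + |t| ^ 3) * Real.exp (-|t| / 2)) ≤
      p.factorial * 2 ^ p + (p + 3).factorial * 2 ^ (p + 3) := by
  have h : ∀ m : ℕ, |t| ^ m * Real.exp (-|t| / 2) ≤ m.factorial * 2 ^ m := fun m => by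
    have h1 := Real.pow_div_factorial_le_exp (|t| / 2) (by positivity) m
    rw [div_pow, div_div, div_le_iff₀ (by positivity)] at h1
    rw [neg_div, Real.exp_neg, ← div_eq_mul_inv, div_le_iff₀ (by positivity)]
    linarith
  calc _ = |t| ^ p * Real.exp (-|t| / 2) + |t| ^ (p + 3) * Real.exp (-|t| / 2) := by ring
    _ ≤ _ := add_le_add (h p) (h (p + 3))

theorem iteratedDeriv_gaussian_sub_bspline {n q : ℕ} (hq : q + 3 ≤ n) (x : Fin n → ℝ) {τ : ℝ}
    (hτ : τ ^ 2 = 1) (t : ℝ) :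
    iteratedDeriv q
        (fun s : ℝ => (1 / Real.sqrt (2 * π)) * Real.exp (-s ^ 2 / 2) -
          ∑ k, (max (x k - s / n) 0) ^ (n - 2) / ∏ j ∈ univ.erase k, (x k - x j)) t =
      1 / (2 * π) * (∫ r : ℝ, (-((τ : ℂ) + Complex.I * r)) ^ q *
        Complex.exp (-((τ : ℂ) + Complex.I * r) * t + ((τ : ℂ) + Complex.I * r) ^ 2 / 2)).re -
      (-1) ^ q * ((n - 2).descFactorial q / (n : ℝ) ^ q) *
        ∑ k, max (x k - t / n) 0 ^ (n - 2 - q) / ∏ j ∈ univ.erase k, (x k - x j) := by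
  have h := iteratedDeriv_eq_of_forall_hasDerivAt (q := q) (F := fun i s =>
    1 / (2 * π) * (∫ r : ℝ, (-((τ : ℂ) + Complex.I * r)) ^ i *
        Complex.exp (-((τ : ℂ) + Complex.I * r) * s + ((τ : ℂ) + Complex.I * r) ^ 2 / 2)).re -
      (-1) ^ i * ((n - 2).descFactorial i / (n : ℝ) ^ i) *
        ∑ k, max (x k - s / n) 0 ^ (n - 2 - i) / ∏ j ∈ univ.erase k, (x k - x j))
    fun i hi s => ((Complex.reCLM.hasFDerivAt.comp_hasDerivAt s
      (hasDerivAt_integral_pow_mul_exp hτ i s)).const_mul _).sub (hasDerivAt_bspline x (by omega) s)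
  rw [← congrFun h t]
  congr 1
  funext s
  simp only [pow_zero, one_mul, integral_exp_neg_mul_add_sq_div, Complex.ofReal_re,
    Nat.descFactorial_zero, Nat.cast_one, div_one, Nat.sub_zero]
  have hs : Real.sqrt (2 * π) * Real.sqrt (2 * π) = 2 * π := Real.mul_self_sqrt (by positivity)
  have hc : 1 / Real.sqrt (2 * π) = 1 / (2 * π) * Real.sqrt (2 * π) := by
    rw [div_mul_eq_mul_div, div_eq_div_iff (by positivity) (by positivity), one_mul, one_mul, hs]
  rw [hc, mul_assoc]

/-- B-splines with knots satisfying the Berry–Esseen-type assumptions converge to the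
Gaussian density in every Schwartz seminorm. -/
theorem bspline_gaussian_schwartz (p q : ℕ) :
    ∃ C > (0 : ℝ), ∃ ε > (0 : ℝ), ∃ N : ℕ, ∀ n : ℕ, N ≤ n →
      ∀ x : Fin n → ℝ, StrictMono x →
        (∑ k, x k) = 0 → (∑ k, (x k) ^ 2) = 1 → (∑ k, |x k| ^ 3) ≤ ε →
        ∀ t : ℝ,
          |t ^ p *
            iteratedDeriv q
              (fun s : ℝ =>
                (1 / Real.sqrt (2 * π)) * Real.exp (-s ^ 2 / 2) -
                  ∑ k, (max (x k - s / n) 0) ^ (n - 2) /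
                    ∏ j ∈ univ.erase k, (x k - x j)) t|
            ≤ C * ∑ k, |x k| ^ 3 := by
  set A : ℝ := 64 * Real.exp 1 * (4 * (q + 12 : ℕ)) ^ (q + 12) +
    Real.exp 1 * (q + 3).factorial * 2 ^ (q + 3) +
    q * (q + 1) * (Real.exp 1 * (q + 1).factorial * 2 ^ (q + 1)) with hA
  set A' : ℝ := 4 * (q + 12 : ℕ) * (Real.exp 1 * (q + 1).factorial * 2 ^ (q + 1)) with hA'
  have hA0 : 0 < A := by positivity
  have hA0' : 0 < A' := by positivity
  refine ⟨(A + A') * (p.factorial * 2 ^ p + (p + 3).factorial * 2 ^ (p + 3)), by positivity,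
    (1 / (4 * (q + 12 : ℕ))) ^ 3, by positivity, q + 8, fun n hn x hmono h0 h2 hε t => ?_⟩
  set δ := ∑ k, |x k| ^ 3 with hδ
  have hδ0 : 0 ≤ δ := Finset.sum_nonneg fun k _ => by positivity
  have hx : ∀ k, |x k| ≤ 1 / (4 * (q + 12 : ℕ)) := fun k =>
    le_of_pow_le_pow_left₀ three_ne_zero (by positivity)
      ((Finset.single_le_sum (f := fun k => |x k| ^ 3) (fun j _ => by positivity)
        (Finset.mem_univ k)).trans hε)
  obtain ⟨τ, hτ, hτt⟩ : ∃ τ : ℝ, τ ^ 2 = 1 ∧ τ * t = |t| := by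
    rcases le_total 0 t with h | h
    · exact ⟨1, by norm_num, by rw [abs_of_nonneg h, one_mul]⟩
    · exact ⟨-1, by norm_num, by rw [abs_of_nonpos h, neg_one_mul]⟩
  rw [iteratedDeriv_gaussian_sub_bspline (by omega) x hτ t, abs_mul, abs_pow]
  set M := δ * (1 + |t| ^ 3) * Real.exp (-|t| / 2) with hM
  have hM0 : 0 ≤ M := by positivity
  calc _ ≤ |t| ^ p * ((A + A') * M) := by
        refine mul_le_mul_of_nonneg_left ?_ (by positivity)
        rcases le_total |t / n| (1 / (4 * (q + 12 : ℕ))) with ht | ht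
        · refine (abs_gaussian_sub_bspline_le_of_small hn hmono.injective h0 h2 hx ht hτ
            hτt).trans ?_
          rw [add_mul A]
          exact le_add_of_nonneg_right (mul_nonneg hA0'.le hM0)
        · refine (abs_gaussian_sub_bspline_le_of_large hn hmono.injective h2 hx ht hτ hτt).trans ?_
          rw [add_mul A]
          exact le_add_of_nonneg_left (mul_nonneg hA0.le hM0)
    _ = (A + A') * (|t| ^ p * ((1 + |t| ^ 3) * Real.exp (-|t| / 2))) * δ := by ring
    _ ≤ _ := by
        gcongr
        exact abs_pow_mul_one_add_pow_three_mul_exp_le p t
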